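/- arXiv:1104.1827 — 2 statements merged into one kernel-verified Lean document; each statement's English description precedes it below -/
import Mathlib

section
/- For every infinite-dimensional complex Hilbert space H there exists a bounded, uniformly continuous function f : [0,∞) → H such that the orbit {f_s : s ≥ 0} (where f_s(t) = f(s+t)) is relatively compact in the weak topology of C_b([0,∞),H), 0 lies in the weak closure of this orbit, and neither lim_{T→∞} (1/T) ∫_{0}^{T} ‖f(t)‖ dt nor lim_{T→∞} (1/T) ∫_{0}^{T} ‖f(t)‖² dt exists. -/
open BoundedContinuousFunction Filter Topology NNReal

/-- The translate `f_s` of `f : ℝ≥0 →ᵇ X` on the half line `[0,∞) = ℝ≥0`, defined by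
`f_s t = f (s + t)`. -/
noncomputable def translateBCFP {X : Type*} [SeminormedAddCommGroup X] (f : ℝ≥0 →ᵇ X)
    (s : ℝ≥0) : ℝ≥0 →ᵇ X :=
  f.compContinuous ⟨fun t => s + t, by continuity⟩

/-- The sum of `N` pairwise orthogonal vectors of norm at most `C` has norm at most `C * √N`. -/
theorem norm_sq_sum_le_of_pairwise_orthogonal {H : Type*} [NormedAddCommGroup H]
    [InnerProductSpace ℂ H] {v : ℕ → H} {C : ℝ} (hv : ∀ k, ‖v k‖ ≤ C)
    (horth : ∀ i j, i < j → inner ℂ (v i) (v j) = 0) (N : ℕ) :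
    ‖∑ k ∈ Finset.range N, v k‖ ^ 2 ≤ C ^ 2 * N := by
  induction N with
  | zero => simp
  | succ N ih =>
    have h0 : inner ℂ (∑ k ∈ Finset.range N, v k) (v N) = 0 := by
      rw [sum_inner]
      exact Finset.sum_eq_zero fun i hi => horth i N (Finset.mem_range.1 hi)
    have h1 := norm_add_sq_eq_norm_sq_add_norm_sq_of_inner_eq_zero _ _ h0
    have h2 : ‖v N‖ ^ 2 ≤ C ^ 2 := pow_le_pow_left₀ (norm_nonneg _) (hv N) 2
    rw [Finset.sum_range_succ]
    push_cast
    nlinarith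

/-- If the values of `f` at points of distance at least `d` are orthogonal, then the translates of
`f` tend weakly to zero. -/
theorem tendsto_dual_translateBCFP {H : Type*} [NormedAddCommGroup H] [InnerProductSpace ℂ H]
    (f : ℝ≥0 →ᵇ H) (d : ℝ≥0) (horth : ∀ s t : ℝ≥0, s + d ≤ t → inner ℂ (f s) (f t) = 0)
    (φ : StrongDual ℂ (ℝ≥0 →ᵇ H)) :
    Tendsto (fun s => φ (translateBCFP f s)) atTop (𝓝 0) := by
  by_contra hcon
  obtain ⟨ε, hε, hfreq⟩ : ∃ ε > 0, ∀ N : ℝ≥0, ∃ s ≥ N, ε ≤ ‖φ (translateBCFP f s)‖ := by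
    simpa [Metric.tendsto_atTop] using hcon
  choose g hg hgε using hfreq
  let s : ℕ → ℝ≥0 := fun k => Nat.rec (g 0) (fun _ x => g (x + d)) k
  have hstep (k : ℕ) : s k + d ≤ s (k + 1) := hg _
  have hmono : Monotone s := monotone_nat_of_le_succ fun k => le_self_add.trans (hstep k)
  have hsep (i j : ℕ) (hij : i < j) : s i + d ≤ s j := (hstep i).trans (hmono hij)
  have hsε (k : ℕ) : ε ≤ ‖φ (translateBCFP f (s k))‖ := by
    cases k with
    | zero => exact hgε _
    | succ k => exact hgε _
  have hc (k : ℕ) : ∃ c : ℂ, ‖c‖ = 1 ∧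
      c * φ (translateBCFP f (s k)) = (‖φ (translateBCFP f (s k))‖ : ℂ) := by
    obtain ⟨c, hc, h⟩ := RCLike.exists_norm_eq_mul_self (φ (translateBCFP f (s k)))
    exact ⟨c, hc, h.symm⟩
  choose c hc1 hc using hc
  have hsum (N : ℕ) : ‖∑ k ∈ Finset.range N, c k • translateBCFP f (s k)‖ ≤ ‖f‖ * √N := by
    rw [BoundedContinuousFunction.norm_le (by positivity)]
    intro t
    have hN := norm_sq_sum_le_of_pairwise_orthogonal (v := fun k => c k • f (s k + t)) (C := ‖f‖)
      (fun k => by rw [norm_smul, hc1, one_mul]; exact f.norm_coe_le_norm _)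
      (fun i j hij => by
        rw [inner_smul_left, inner_smul_right, horth, mul_zero, mul_zero]
        calc s i + t + d = s i + d + t := by ring
          _ ≤ s j + t := by gcongr; exact hsep i j hij) N
    have heq : (∑ k ∈ Finset.range N, c k • translateBCFP f (s k)) t
        = ∑ k ∈ Finset.range N, c k • f (s k + t) := by
      simp [BoundedContinuousFunction.sum_apply, translateBCFP]
    rw [heq]
    refine le_of_sq_le_sq ?_ (by positivity)
    rw [mul_pow, Real.sq_sqrt (by positivity)]
    exact hN
  have hlow (N : ℕ) : N * ε ≤ ‖φ (∑ k ∈ Finset.range N, c k • translateBCFP f (s k))‖ := by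
    have : φ (∑ k ∈ Finset.range N, c k • translateBCFP f (s k))
        = ((∑ k ∈ Finset.range N, ‖φ (translateBCFP f (s k))‖ : ℝ) : ℂ) := by
      rw [map_sum, Complex.ofReal_sum]
      exact Finset.sum_congr rfl fun k _ => by rw [map_smul, smul_eq_mul, hc]
    rw [this, Complex.norm_real, Real.norm_of_nonneg (Finset.sum_nonneg fun _ _ => norm_nonneg _)]
    simpa using Finset.card_nsmul_le_sum (Finset.range N) _ ε fun k _ => hsε k
  have hbound (N : ℕ) : √N * ε ≤ ‖φ‖ * ‖f‖ := by
    rcases N.eq_zero_or_pos with rfl | hN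
    · simp only [Nat.cast_zero, Real.sqrt_zero, zero_mul]
      positivity
    have h1 := (hlow N).trans ((φ.le_opNorm _).trans
      (mul_le_mul_of_nonneg_left (hsum N) (norm_nonneg φ)))
    have h2 : 0 < √(N : ℝ) := by positivity
    have h3 : √(N : ℝ) * √(N : ℝ) = N := Real.mul_self_sqrt (by positivity)
    refine le_of_mul_le_mul_left ?_ h2
    calc √(N : ℝ) * (√N * ε) = N * ε := by rw [← mul_assoc, h3]
      _ ≤ _ := h1
      _ = _ := by ring
  have htop : Tendsto (fun N : ℕ => √(N : ℝ) * ε) atTop atTop :=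
    (Real.tendsto_sqrt_atTop.comp tendsto_natCast_atTop_atTop).atTop_mul_const hε
  obtain ⟨N, hN⟩ := (htop.eventually_gt_atTop (‖φ‖ * ‖f‖)).exists
  exact (hbound N).not_gt hN

/-- Translation of a uniformly continuous function is norm continuous. -/
theorem continuous_translateBCFP {X : Type*} [SeminormedAddCommGroup X] {f : ℝ≥0 →ᵇ X}
    (hf : UniformContinuous f) : Continuous (translateBCFP f) := by
  rw [Metric.continuous_iff]
  intro s ε hε
  obtain ⟨δ, hδ, h⟩ := Metric.uniformContinuous_iff.1 hf (ε / 2) (half_pos hε)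
  refine ⟨δ, hδ, fun s' hs' => ?_⟩
  refine lt_of_le_of_lt ((BoundedContinuousFunction.dist_le (half_pos hε).le).2 fun t => ?_)
    (half_lt_self hε)
  refine (h (a := s' + t) (b := s + t) ?_).le
  rw [NNReal.dist_eq] at hs' ⊢
  push_cast
  rwa [add_sub_add_right_eq_sub]

theorem tendsto_toWeakSpace_of_forall_dual {α E : Type*} [NormedAddCommGroup E] [NormedSpace ℂ E]
    {l : Filter α} {u : α → E} {x : E}
    (h : ∀ φ : StrongDual ℂ E, Tendsto (fun a => φ (u a)) l (𝓝 (φ x))) :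
    Tendsto (fun a => toWeakSpace ℂ E (u a)) l (𝓝 (toWeakSpace ℂ E x)) := by
  refine (WeakBilin.tendsto_iff_forall_eval_tendsto (topDualPairing ℂ E).flip
    fun x y hxy => ?_).2 h
  by_contra hne
  obtain ⟨φ, hφ⟩ := SeparatingDual.exists_separating_of_ne (R := ℂ) hne
  exact hφ (congrArg (fun L => L φ) hxy)

/-- A function which equals `c` on intervals `[T, 2T]` with `T` arbitrarily large can only have `c`
as its Cesàro limit. -/
theorem cesaro_limit_eq_of_frequently_const {h : ℝ → ℝ} (hh : Continuous h) {L c : ℝ}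
    (hL : Tendsto (fun T : ℝ => (1/T) * ∫ t in (0:ℝ)..T, h t) atTop (𝓝 L))
    (hc : ∃ᶠ T : ℝ in atTop, ∀ t ∈ Set.Icc T (2 * T), h t = c) : L = c := by
  have h2 : Tendsto (fun T : ℝ => 2 * T) atTop atTop := tendsto_id.const_mul_atTop two_pos
  have hlim := ((hL.comp h2).const_mul 2).sub hL
  rw [two_mul, add_sub_cancel_right] at hlim
  refine isClosed_singleton.mem_of_frequently_of_tendsto (s := {c}) ?_ hlim
  refine (hc.and_eventually (eventually_gt_atTop 0)).mono fun T ⟨hT, hT0⟩ => ?_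
  have hint : ∫ t in T..(2 * T), h t = T * c := by
    rw [intervalIntegral.integral_congr (g := fun _ => c)]
    · rw [intervalIntegral.integral_const, smul_eq_mul]
      ring
    · rwa [Set.uIcc_of_le (by linarith)]
  have hadd := intervalIntegral.integral_add_adjacent_intervals
    (hh.intervalIntegrable (μ := MeasureTheory.volume) 0 T) (hh.intervalIntegrable T (2 * T))
  rw [hint] at hadd
  simp only [Function.comp_apply, ← hadd, Set.mem_singleton_iff]
  field_simp
  ring

/-- The quarter circle from `e n` (at `x = 0`) to `e (n + 1)` (at `x = 1`). -/
noncomputable def quarterCircle {H : Type*} [AddCommGroup H] [Module ℂ H]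
    (e : ℕ → H) (n : ℕ) (x : ℝ) : H :=
  (Real.cos (Real.pi / 2 * x) : ℂ) • e n + (Real.sin (Real.pi / 2 * x) : ℂ) • e (n + 1)

/-- The path of unit vectors running through the vectors `e 0, e 1, e 2, …` along quarter
circles. -/
noncomputable def quarterCirclePath {H : Type*} [AddCommGroup H] [Module ℂ H]
    (e : ℕ → H) (t : ℝ≥0) : H :=
  quarterCircle e ⌊t⌋₊ (t - ⌊t⌋₊)

section QuarterCircle

variable {H : Type*} [NormedAddCommGroup H] [InnerProductSpace ℂ H] {e : ℕ → H}

theorem norm_quarterCircle (he : Orthonormal ℂ e) (n : ℕ) (x : ℝ) : ‖quarterCircle e n x‖ = 1 := by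
  have h0 : inner ℂ ((Real.cos (Real.pi / 2 * x) : ℂ) • e n)
      ((Real.sin (Real.pi / 2 * x) : ℂ) • e (n + 1)) = 0 := by
    rw [inner_smul_left, inner_smul_right, he.2 n.succ_ne_self.symm, mul_zero, mul_zero]
  have h1 := norm_add_sq_eq_norm_sq_add_norm_sq_of_inner_eq_zero _ _ h0
  rw [norm_smul, norm_smul, he.1, he.1, Complex.norm_real, Complex.norm_real, mul_one, mul_one,
    Real.norm_eq_abs, Real.norm_eq_abs, abs_mul_abs_self, abs_mul_abs_self, ← sq, ← sq, ← sq,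
    Real.cos_sq_add_sin_sq] at h1
  exact (pow_eq_one_iff_of_nonneg (norm_nonneg _) two_ne_zero).1 h1

theorem dist_quarterCircle_le (he : Orthonormal ℂ e) (n : ℕ) (x y : ℝ) :
    dist (quarterCircle e n x) (quarterCircle e n y) ≤ Real.pi * |x - y| := by
  have hxy : |Real.pi / 2 * x - Real.pi / 2 * y| = Real.pi / 2 * |x - y| := by
    rw [← mul_sub, abs_mul, abs_of_pos (by positivity)]
  have hc := Real.abs_cos_sub_cos_le (Real.pi / 2 * x) (Real.pi / 2 * y)
  have hs := Real.abs_sin_sub_sin_le (Real.pi / 2 * x) (Real.pi / 2 * y)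
  refine (dist_add_add_le _ _ _ _).trans ?_
  rw [dist_eq_norm, dist_eq_norm, ← sub_smul, ← sub_smul, norm_smul, norm_smul, he.1, he.1,
    ← Complex.ofReal_sub, ← Complex.ofReal_sub, Complex.norm_real, Complex.norm_real,
    Real.norm_eq_abs, Real.norm_eq_abs]
  linarith

theorem quarterCircle_one (n : ℕ) : quarterCircle e n 1 = quarterCircle e (n + 1) 0 := by
  simp [quarterCircle]

theorem norm_quarterCirclePath (he : Orthonormal ℂ e) (t : ℝ≥0) : ‖quarterCirclePath e t‖ = 1 :=
  norm_quarterCircle he _ _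

theorem dist_quarterCirclePath_le (he : Orthonormal ℂ e) (s t : ℝ≥0) :
    dist (quarterCirclePath e s) (quarterCirclePath e t) ≤ Real.pi * dist s t := by
  wlog hst : s ≤ t generalizing s t
  · rw [dist_comm, dist_comm s]
    exact this t s (le_of_not_ge hst)
  have hst' : (s : ℝ) ≤ t := hst
  have hs1 : (s : ℝ) < ⌊s⌋₊ + 1 := mod_cast Nat.lt_floor_add_one s
  have ht0 : (⌊t⌋₊ : ℝ) ≤ t := mod_cast Nat.floor_le t.2
  rw [NNReal.dist_eq, abs_sub_comm, abs_of_nonneg (by linarith)]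
  have hfl : ⌊s⌋₊ ≤ ⌊t⌋₊ := Nat.floor_mono hst
  rcases lt_or_ge ⌊t⌋₊ (⌊s⌋₊ + 2) with h | h
  · rcases (by lia : ⌊t⌋₊ = ⌊s⌋₊ ∨ ⌊t⌋₊ = ⌊s⌋₊ + 1) with h | h
    · have h1 := dist_quarterCircle_le he ⌊s⌋₊ (s - ⌊s⌋₊) (t - ⌊s⌋₊)
      rw [sub_sub_sub_cancel_right, abs_sub_comm, abs_of_nonneg (by linarith)] at h1
      rwa [quarterCirclePath, quarterCirclePath, h]
    · have h' : (⌊t⌋₊ : ℝ) = ⌊s⌋₊ + 1 := mod_cast h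
      refine (dist_triangle _ (quarterCircle e ⌊s⌋₊ 1) _).trans ?_
      have h1 := dist_quarterCircle_le he ⌊s⌋₊ (s - ⌊s⌋₊) 1
      have h2 := dist_quarterCircle_le he ⌊t⌋₊ 0 (t - ⌊t⌋₊)
      rw [h, ← quarterCircle_one, ← h] at h2
      rw [abs_of_nonpos (by linarith)] at h1 h2
      refine (add_le_add h1 h2).trans_eq ?_
      rw [h']
      ring
  · have h' : (⌊s⌋₊ : ℝ) + 2 ≤ ⌊t⌋₊ := mod_cast h
    calc dist (quarterCirclePath e s) (quarterCirclePath e t)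
        ≤ ‖quarterCirclePath e s‖ + ‖quarterCirclePath e t‖ := dist_le_norm_add_norm _ _
      _ = 2 := by rw [norm_quarterCirclePath he, norm_quarterCirclePath he]; norm_num
      _ ≤ Real.pi * 1 := by linarith [Real.pi_gt_three]
      _ ≤ Real.pi * (t - s) := by gcongr; linarith

theorem inner_quarterCirclePath_eq_zero (he : Orthonormal ℂ e) {s t : ℝ≥0} (hst : s + 2 ≤ t) :
    inner ℂ (quarterCirclePath e s) (quarterCirclePath e t) = 0 := by
  have h : ⌊s⌋₊ + 2 ≤ ⌊t⌋₊ := by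
    rw [← Nat.floor_add_ofNat (zero_le (a := s))]
    exact Nat.floor_mono hst
  simp only [quarterCirclePath, quarterCircle, inner_add_left, inner_add_right, inner_smul_left,
    inner_smul_right]
  rw [he.2 (by lia), he.2 (by lia), he.2 (by lia), he.2 (by lia)]
  simp

end QuarterCircle

/-- A slowly oscillating function which is constant, equal to `0` or to `1`, on arbitrarily long
intervals. -/
noncomputable def slowOscillation (t : ℝ≥0) : ℝ :=
  max (min (4 * Real.cos (Real.log (1 + t))) 1) 0

theorem slowOscillation_nonneg (t : ℝ≥0) : 0 ≤ slowOscillation t := le_max_right _ _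

theorem slowOscillation_le_one (t : ℝ≥0) : slowOscillation t ≤ 1 :=
  max_le (min_le_right _ _) zero_le_one

theorem abs_log_one_add_sub_le (s t : ℝ≥0) :
    |Real.log (1 + s) - Real.log (1 + t)| ≤ |(s : ℝ) - t| := by
  wlog hst : s ≤ t generalizing s t
  · rw [abs_sub_comm, abs_sub_comm (s : ℝ)]
    exact this t s (le_of_not_ge hst)
  have hst' : (s : ℝ) ≤ t := hst
  have hs : (0 : ℝ) < 1 + s := by positivity
  have ht : (0 : ℝ) < 1 + t := by positivity
  have hlog : Real.log (1 + s) ≤ Real.log (1 + t) := Real.log_le_log hs (by linarith)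
  rw [abs_sub_comm, abs_sub_comm (s : ℝ), abs_of_nonneg (by linarith), abs_of_nonneg (by linarith),
    ← Real.log_div ht.ne' hs.ne']
  refine (Real.log_le_sub_one_of_pos (by positivity)).trans ?_
  rw [div_sub_one hs.ne', div_le_iff₀ hs]
  nlinarith [mul_nonneg (sub_nonneg.2 hst') s.2]

theorem abs_slowOscillation_sub_le (s t : ℝ≥0) :
    |slowOscillation s - slowOscillation t| ≤ 4 * |(s : ℝ) - t| := by
  refine (abs_max_sub_max_le_abs _ _ _).trans ((abs_min_sub_min_le_max _ _ _ _).trans ?_)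
  rw [sub_self, abs_zero, max_eq_left (abs_nonneg _), ← mul_sub, abs_mul, abs_of_pos four_pos]
  exact mul_le_mul_of_nonneg_left
    ((Real.abs_cos_sub_cos_le _ _).trans (abs_log_one_add_sub_le s t)) zero_le_four

/-- On `[T, 2T]` with `T = exp (a + 2πk)` the function `slowOscillation` depends only on the cosine
near `a`. -/
theorem frequently_slowOscillation_eq {a c : ℝ} (ha : 0 ≤ a)
    (hc : ∀ x ∈ Set.Icc a (a + 6 / 5), max (min (4 * Real.cos x) 1) 0 = c) :
    ∃ᶠ T : ℝ in atTop, ∀ t ∈ Set.Icc T (2 * T), slowOscillation t.toNNReal = c := by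
  have htop : Tendsto (fun k : ℕ => Real.exp (a + k * (2 * Real.pi))) atTop atTop :=
    Real.tendsto_exp_atTop.comp (tendsto_atTop_add_const_left _ _
      (tendsto_natCast_atTop_atTop.atTop_mul_const Real.two_pi_pos))
  refine htop.frequently (Eventually.of_forall fun k t ht => ?_).frequently
  have hlog3 : Real.log 3 ≤ 6 / 5 := by
    have h := Real.log_le_sub_one_of_pos (x := 3 / 2) (by norm_num)
    rw [Real.log_div (by norm_num) (by norm_num)] at h
    linarith [Real.log_two_lt_d9]
  have hy : 0 ≤ a + k * (2 * Real.pi) := by positivity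
  have hT1 : 1 ≤ Real.exp (a + k * (2 * Real.pi)) := Real.one_le_exp hy
  have ht0 : 0 ≤ t := by linarith [ht.1]
  have hlow : a + k * (2 * Real.pi) ≤ Real.log (1 + t) := by
    rw [Real.le_log_iff_exp_le (by linarith)]
    linarith [ht.1]
  have hupp : Real.log (1 + t) ≤ a + k * (2 * Real.pi) + 6 / 5 := by
    calc Real.log (1 + t) ≤ Real.log (Real.exp (a + k * (2 * Real.pi)) * 3) :=
          Real.log_le_log (by linarith) (by linarith [ht.2])
      _ = a + k * (2 * Real.pi) + Real.log 3 := by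
          rw [Real.log_mul (Real.exp_pos _).ne' (by norm_num), Real.log_exp]
      _ ≤ _ := by linarith
  rw [slowOscillation, Real.coe_toNNReal _ ht0, ← Real.cos_sub_nat_mul_two_pi _ k]
  exact hc _ ⟨by linarith, by linarith⟩

theorem frequently_slowOscillation_eq_one :
    ∃ᶠ T : ℝ in atTop, ∀ t ∈ Set.Icc T (2 * T), slowOscillation t.toNNReal = 1 := by
  refine frequently_slowOscillation_eq le_rfl fun x hx => ?_
  have h := Real.one_sub_sq_div_two_le_cos (x := x)
  have hx1 : x ≤ 6 / 5 := by linarith [hx.2]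
  rw [min_eq_right (by nlinarith [hx.1]), max_eq_left zero_le_one]

theorem frequently_slowOscillation_eq_zero :
    ∃ᶠ T : ℝ in atTop, ∀ t ∈ Set.Icc T (2 * T), slowOscillation t.toNNReal = 0 := by
  refine frequently_slowOscillation_eq (a := Real.pi / 2) (by positivity) fun x hx => ?_
  have h := Real.cos_nonpos_of_pi_div_two_le_of_le hx.1 (by linarith [hx.2, Real.pi_gt_three])
  exact max_eq_right ((min_le_left _ _).trans (by linarith))

/-- An infinite-dimensional inner product space contains an orthonormal sequence. -/
theorem exists_orthonormal_seq {H : Type*} [NormedAddCommGroup H] [InnerProductSpace ℂ H]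
    (hH : ¬ FiniteDimensional ℂ H) : ∃ e : ℕ → H, Orthonormal ℂ e := by
  let b := Module.Basis.ofVectorSpace ℂ H
  have : Infinite (Module.Basis.ofVectorSpaceIndex ℂ H) := by
    by_contra hfin
    rw [not_infinite_iff_finite] at hfin
    exact hH (Module.Finite.of_basis b)
  exact ⟨_, InnerProductSpace.gramSchmidtNormed_orthonormal
    (b.linearIndependent.comp _ (Infinite.natEmbedding _).injective)⟩

/-- For every infinite-dimensional complex Hilbert space `H` there is a bounded uniformly
continuous `f : [0,∞) → H` whose orbit `{f_s : s ≥ 0}` is relatively compact in the weak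
topology of `C_b([0,∞),H)` with `0` in the weak closure of the orbit, while neither the
Cesàro mean of `‖f(t)‖` nor that of `‖f(t)‖²` over `[0,T]` converges as `T → ∞`. -/
theorem exists_EAP0_halfline_with_nonergodic_norm
    (H : Type*) [NormedAddCommGroup H] [InnerProductSpace ℂ H] [CompleteSpace H]
    (hH : ¬ FiniteDimensional ℂ H) :
    ∃ f : ℝ≥0 →ᵇ H, UniformContinuous ⇑f ∧
      IsCompact (closure ((toWeakSpace ℂ (ℝ≥0 →ᵇ H)) '' Set.range (translateBCFP f))) ∧
      (0 : WeakSpace ℂ (ℝ≥0 →ᵇ H)) ∈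
        closure ((toWeakSpace ℂ (ℝ≥0 →ᵇ H)) '' Set.range (translateBCFP f)) ∧
      (¬ ∃ L : ℝ, Tendsto (fun T : ℝ => (1/T) * ∫ t in (0:ℝ)..T, ‖f t.toNNReal‖)
        atTop (𝓝 L)) ∧
      (¬ ∃ L : ℝ, Tendsto (fun T : ℝ => (1/T) * ∫ t in (0:ℝ)..T, ‖f t.toNNReal‖^2)
        atTop (𝓝 L)) := by
  obtain ⟨e, he⟩ := exists_orthonormal_seq hH
  let F : ℝ≥0 → H := fun t => (slowOscillation t : ℂ) • quarterCirclePath e t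
  have hFnorm (t : ℝ≥0) : ‖F t‖ = slowOscillation t := by
    rw [norm_smul, norm_quarterCirclePath he, mul_one, Complex.norm_real,
      Real.norm_of_nonneg (slowOscillation_nonneg t)]
  have hFlip : LipschitzWith (4 + Real.toNNReal Real.pi) F := by
    refine LipschitzWith.of_dist_le_mul fun s t => ?_
    calc dist (F s) (F t)
        ≤ dist (F s) ((slowOscillation s : ℂ) • quarterCirclePath e t)
          + dist ((slowOscillation s : ℂ) • quarterCirclePath e t) (F t) := dist_triangle _ _ _
      _ = slowOscillation s * dist (quarterCirclePath e s) (quarterCirclePath e t)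
          + |slowOscillation s - slowOscillation t| := by
          rw [dist_smul₀, Complex.norm_real, Real.norm_of_nonneg (slowOscillation_nonneg s),
            dist_eq_norm ((slowOscillation s : ℂ) • quarterCirclePath e t), ← sub_smul, norm_smul,
            norm_quarterCirclePath he, mul_one, ← Complex.ofReal_sub, Complex.norm_real,
            Real.norm_eq_abs]
      _ ≤ 1 * (Real.pi * dist s t) + 4 * dist s t :=
          add_le_add (mul_le_mul (slowOscillation_le_one s) (dist_quarterCirclePath_le he s t)
            dist_nonneg zero_le_one) (abs_slowOscillation_sub_le s t)
      _ = ((4 + Real.toNNReal Real.pi : ℝ≥0) : ℝ) * dist s t := by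
          push_cast
          rw [Real.coe_toNNReal _ Real.pi_pos.le]
          ring
  let f : ℝ≥0 →ᵇ H := BoundedContinuousFunction.ofNormedAddCommGroup F hFlip.continuous 1
    fun t => (hFnorm t).trans_le (slowOscillation_le_one t)
  have hfnorm (t : ℝ≥0) : ‖f t‖ = slowOscillation t := hFnorm t
  have hunif : UniformContinuous f := hFlip.uniformContinuous
  have horth (s t : ℝ≥0) (hst : s + 2 ≤ t) : inner ℂ (f s) (f t) = 0 := by
    change inner ℂ (F s) (F t) = 0
    rw [inner_smul_left, inner_smul_right, inner_quarterCirclePath_eq_zero he hst, mul_zero,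
      mul_zero]
  let W : ℝ≥0 → WeakSpace ℂ (ℝ≥0 →ᵇ H) := fun s => toWeakSpace ℂ _ (translateBCFP f s)
  have hW : (toWeakSpace ℂ (ℝ≥0 →ᵇ H)) '' Set.range (translateBCFP f) = Set.range W :=
    (Set.range_comp _ _).symm
  have hlim : Tendsto W atTop (𝓝 0) := by
    have h := tendsto_toWeakSpace_of_forall_dual (u := translateBCFP f) (x := 0) (l := atTop)
      fun φ => by rw [map_zero]; exact tendsto_dual_translateBCFP f 2 horth φ
    rwa [map_zero] at h
  have hcont : Continuous W :=
    (toWeakSpaceCLM ℂ (ℝ≥0 →ᵇ H)).continuous.comp (continuous_translateBCFP hunif)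
  have hnorm_cont : Continuous fun t : ℝ => ‖f t.toNNReal‖ :=
    (f.continuous.comp continuous_real_toNNReal).norm
  have hsq_cont : Continuous fun t : ℝ => ‖f t.toNNReal‖ ^ 2 := hnorm_cont.pow 2
  refine ⟨f, hunif, ?_, ?_, ?_, ?_⟩
  · rw [hW]
    have hcpt : IsCompact (insert 0 (Set.range W)) :=
      Tendsto.isCompact_insert_range_of_cocompact (by rwa [cocompact_eq_atTop]) hcont
    exact hcpt.closure_of_subset (Set.subset_insert _ _)
  · rw [hW]
    exact mem_closure_of_tendsto hlim (Eventually.of_forall Set.mem_range_self)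
  · rintro ⟨L, hL⟩
    have h1 := cesaro_limit_eq_of_frequently_const hnorm_cont hL (c := 1)
      (frequently_slowOscillation_eq_one.mono fun T hT t ht => by rw [hfnorm, hT t ht])
    have h0 := cesaro_limit_eq_of_frequently_const hnorm_cont hL (c := 0)
      (frequently_slowOscillation_eq_zero.mono fun T hT t ht => by rw [hfnorm, hT t ht])
    exact one_ne_zero (h1.symm.trans h0)
  · rintro ⟨L, hL⟩
    have h1 := cesaro_limit_eq_of_frequently_const hsq_cont hL (c := 1)
      (frequently_slowOscillation_eq_one.mono fun T hT t ht => by rw [hfnorm, hT t ht, one_pow])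
    have h0 := cesaro_limit_eq_of_frequently_const hsq_cont hL (c := 0)
      (frequently_slowOscillation_eq_zero.mono fun T hT t ht => by
        rw [hfnorm, hT t ht, zero_pow two_ne_zero])
    exact one_ne_zero (h1.symm.trans h0)
end

section
/- For every infinite-dimensional complex Hilbert space H there exists a function f : ℝ → H that is Eberlein almost periodic (indeed f ∈ EAP_0(ℝ,H)), but such that the real-valued function t ↦ ‖f(t)‖ is NOT Eberlein almost periodic, i.e. the orbit {‖f(·)‖_s : s ∈ ℝ} is not relatively compact in the weak topology of C_b(ℝ,ℝ). -/
open BoundedContinuousFunction Filter Topology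

/-- The translate `f_s` of `f : ℝ →ᵇ X`, defined by `f_s t = f (s + t)`. -/
noncomputable def translateBCF {X : Type*} [SeminormedAddCommGroup X] (f : ℝ →ᵇ X) (s : ℝ) :
    ℝ →ᵇ X :=
  f.compContinuous ⟨fun t => s + t, by continuity⟩

/-- A triangular bump of height `1` and width `1 / 2` centred at each integer. -/
noncomputable def integerBump (t : ℝ) : ℝ := max 0 (1 - 4 * |t - round t|)

lemma integerBump_nonneg (t : ℝ) : 0 ≤ integerBump t := le_max_left _ _

lemma integerBump_le_one (t : ℝ) : integerBump t ≤ 1 :=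
  max_le zero_le_one (by linarith [abs_nonneg (t - round t)])

lemma integerBump_intCast (n : ℤ) : integerBump n = 1 := by simp [integerBump]

lemma one_le_abs_round_sub {s t : ℝ} (h : round s ≠ round t) :
    (1 : ℝ) ≤ |(round s : ℝ) - round t| := by
  exact_mod_cast Int.one_le_abs (sub_ne_zero.2 h)

lemma integerBump_eq_zero {s t : ℝ} (hst : |s - t| < 1 / 4) (h : round s ≠ round t) :
    integerBump s = 0 := by
  have h1 := one_le_abs_round_sub h
  have h2 := round_le t (round s)
  have h3 := abs_sub_le (round s : ℝ) t (round t)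
  have h4 := abs_sub_le t s (round s)
  rw [abs_sub_comm (round s : ℝ) t] at h3
  rw [abs_sub_comm t s] at h4
  exact max_eq_left (by linarith)

lemma abs_integerBump_sub_le {s t : ℝ} (h : round s = round t) :
    |integerBump s - integerBump t| ≤ 4 * |s - t| := by
  have h1 := abs_max_sub_max_le_max 0 (1 - 4 * |s - round s|) 0 (1 - 4 * |t - round t|)
  refine h1.trans (max_le (by simp) ?_)
  have h2 := abs_abs_sub_abs_le (t - round t) (s - round s)
  rw [h] at h2 ⊢
  rw [show 1 - 4 * |s - round t| - (1 - 4 * |t - round t|)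
    = 4 * (|t - round t| - |s - round t|) by ring, abs_mul, abs_sub_comm s t]
  norm_num
  simpa using h2

section Construction

variable {H : Type*} [NormedAddCommGroup H] [InnerProductSpace ℂ H]

lemma uniformContinuous_integerBump_smul {F : ℤ → H} (hF : ∀ n, ‖F n‖ ≤ 1) :
    UniformContinuous fun t : ℝ => (integerBump t : ℂ) • F (round t) := by
  refine Metric.uniformContinuous_iff.2 fun ε hε => ⟨min (1 / 4) (ε / 4), by positivity, ?_⟩
  intro s t hst
  rw [Real.dist_eq] at hst
  have hst1 := hst.trans_le (min_le_left _ _)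
  have hst2 := hst.trans_le (min_le_right _ _)
  by_cases h : round s = round t
  · rw [dist_eq_norm, h, ← sub_smul, norm_smul, ← Complex.ofReal_sub, Complex.norm_real,
      Real.norm_eq_abs]
    have := abs_integerBump_sub_le h
    have := mul_le_of_le_one_right (abs_nonneg (integerBump s - integerBump t)) (hF (round t))
    linarith
  · rw [integerBump_eq_zero hst1 h,
      integerBump_eq_zero (by rwa [abs_sub_comm]) (Ne.symm h)]
    simpa using hε

/-- The function running through bumps at the integers, the one at `n` in direction `F n`. -/
noncomputable def bumpTrain (F : ℤ → H) (hF : ∀ n, ‖F n‖ ≤ 1) : ℝ →ᵇ H :=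
  BoundedContinuousFunction.ofNormedAddCommGroup
    (fun t : ℝ => (integerBump t : ℂ) • F (round t))
    (uniformContinuous_integerBump_smul hF).continuous 1 fun t => by
      rw [norm_smul, Complex.norm_real, Real.norm_of_nonneg (integerBump_nonneg t)]
      exact mul_le_one₀ (integerBump_le_one t) (norm_nonneg _) (hF _)

lemma bumpTrain_apply (F : ℤ → H) (hF : ∀ n, ‖F n‖ ≤ 1) (t : ℝ) :
    bumpTrain F hF t = (integerBump t : ℂ) • F (round t) := rfl

lemma norm_bumpTrain_intCast (F : ℤ → H) (hF : ∀ n, ‖F n‖ ≤ 1) (n : ℤ) :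
    ‖bumpTrain F hF n‖ = ‖F n‖ := by
  simp [bumpTrain_apply, integerBump_intCast]

lemma inner_bumpTrain_eq_zero {F : ℤ → H} (hF : ∀ n, ‖F n‖ ≤ 1)
    (horth : Pairwise fun m n => inner ℂ (F m) (F n) = 0) {s t : ℝ} (hst : 1 < |s - t|) :
    inner ℂ (bumpTrain F hF s) (bumpTrain F hF t) = 0 := by
  have h : round s ≠ round t := by
    intro h
    have h1 := abs_sub_round s
    have h2 := abs_sub_round t
    have h3 := abs_sub_le s (round s) t
    rw [h, abs_sub_comm (round t : ℝ) t] at h3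
    rw [h] at h1
    linarith
  rw [bumpTrain_apply, bumpTrain_apply, inner_smul_left, inner_smul_right, horth h]
  simp

lemma translateBCF_apply {X : Type*} [SeminormedAddCommGroup X] (f : ℝ →ᵇ X) (s t : ℝ) :
    translateBCF f s t = f (s + t) := rfl

lemma continuous_translateBCF {X : Type*} [SeminormedAddCommGroup X] {f : ℝ →ᵇ X}
    (hf : UniformContinuous f) : Continuous (translateBCF f) := by
  refine Metric.continuous_iff.2 fun s ε hε => ?_
  obtain ⟨δ, hδ, h⟩ := Metric.uniformContinuous_iff.1 hf (ε / 2) (half_pos hε)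
  refine ⟨δ, hδ, fun r hr => ?_⟩
  refine ((BoundedContinuousFunction.dist_le (half_pos hε).le).2 fun t => ?_).trans_lt
    (half_lt_self hε)
  exact (h (by simpa using hr)).le

lemma norm_sum_sq_of_pairwise_inner_eq_zero {ι : Type*} (s : Finset ι) (v : ι → H)
    (h : (s : Set ι).Pairwise fun i j => inner ℂ (v i) (v j) = 0) :
    ‖∑ i ∈ s, v i‖ ^ 2 = ∑ i ∈ s, ‖v i‖ ^ 2 := by
  have key : inner ℂ (∑ i ∈ s, v i) (∑ i ∈ s, v i) = ∑ i ∈ s, inner ℂ (v i) (v i) := by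
    rw [sum_inner]
    refine Finset.sum_congr rfl fun i hi => ?_
    rw [inner_sum]
    exact Finset.sum_eq_single_of_mem i hi fun j hj hji => h hi hj hji.symm
  simp only [inner_self_eq_norm_sq_to_K] at key
  exact_mod_cast key

/-- A Bessel inequality: a functional has square-summable values along translates by separated
shifts. -/
lemma sum_norm_sq_translateBCF_le {f : ℝ →ᵇ H} (hf : ‖f‖ ≤ 1)
    (horth : ∀ s t : ℝ, 1 < |s - t| → inner ℂ (f s) (f t) = 0)
    (Λ : StrongDual ℂ (ℝ →ᵇ H)) (A : Finset ℝ)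
    (hA : (A : Set ℝ).Pairwise fun s t => 1 < |s - t|) :
    ∑ s ∈ A, ‖Λ (translateBCF f s)‖ ^ 2 ≤ ‖Λ‖ ^ 2 := by
  set Q := ∑ s ∈ A, ‖Λ (translateBCF f s)‖ ^ 2 with hQ
  have hQ0 : 0 ≤ Q := Finset.sum_nonneg fun _ _ => sq_nonneg _
  set g : ℝ →ᵇ H := ∑ s ∈ A, (starRingEnd ℂ) (Λ (translateBCF f s)) • translateBCF f s with hg
  have hΛg : Λ g = (Q : ℂ) := by
    simp [hg, hQ, map_sum, Complex.conj_mul']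
  have hgn : ‖g‖ ≤ √Q := by
    refine (BoundedContinuousFunction.norm_le (Real.sqrt_nonneg _)).2 fun t => ?_
    refine Real.le_sqrt_of_sq_le ?_
    rw [hg, BoundedContinuousFunction.sum_apply, norm_sum_sq_of_pairwise_inner_eq_zero, hQ]
    · refine Finset.sum_le_sum fun s _ => ?_
      rw [BoundedContinuousFunction.smul_apply, norm_smul, RCLike.norm_conj, translateBCF_apply]
      gcongr
      exact mul_le_of_le_one_right (norm_nonneg _) ((f.norm_coe_le_norm _).trans hf)
    · intro s hs r hr hsr
      simp only [BoundedContinuousFunction.smul_apply, translateBCF_apply]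
      rw [inner_smul_left, inner_smul_right, horth _ _ (by simpa using hA hs hr hsr)]
      simp
  have h1 : Q ≤ ‖Λ‖ * √Q := by
    calc Q = ‖Λ g‖ := by rw [hΛg, Complex.norm_real, Real.norm_of_nonneg hQ0]
      _ ≤ ‖Λ‖ * ‖g‖ := Λ.le_opNorm g
      _ ≤ ‖Λ‖ * √Q := by gcongr
  nlinarith [Real.sq_sqrt hQ0, Real.sqrt_nonneg Q, sq_nonneg (‖Λ‖ - √Q), norm_nonneg Λ]

lemma exists_separated_finset {S : Set ℝ} (hS : ¬ Bornology.IsBounded S) (N : ℕ) :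
    ∃ A : Finset ℝ, A.card = N ∧ (A : Set ℝ) ⊆ S ∧
      (A : Set ℝ).Pairwise fun s t => 1 < |s - t| := by
  induction N with
  | zero => exact ⟨∅, by simp⟩
  | succ N ih =>
    obtain ⟨A, hcard, hAS, hsep⟩ := ih
    have hb : Bornology.IsBounded (Metric.cthickening 1 (A : Set ℝ)) :=
      A.finite_toSet.isBounded.cthickening
    obtain ⟨x, hxS, hx⟩ := Set.not_subset.1 fun h => hS (hb.subset h)
    have hxA : ∀ y ∈ A, 1 < |x - y| := fun y hy => by
      by_contra! h
      exact hx (Metric.mem_cthickening_of_dist_le x y 1 _ hy h)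
    have hxn : x ∉ A := fun h => by
      have := hxA x h
      norm_num at this
    classical
    refine ⟨insert x A, by rw [Finset.card_insert_of_notMem hxn, hcard], ?_, ?_⟩
    · rw [Finset.coe_insert]
      exact Set.insert_subset hxS hAS
    · rw [Finset.coe_insert]
      exact hsep.insert fun y hy _ => ⟨hxA y hy, by rw [abs_sub_comm]; exact hxA y hy⟩

lemma tendsto_apply_translateBCF {f : ℝ →ᵇ H} (hf : ‖f‖ ≤ 1)
    (horth : ∀ s t : ℝ, 1 < |s - t| → inner ℂ (f s) (f t) = 0)
    (Λ : StrongDual ℂ (ℝ →ᵇ H)) :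
    Tendsto (fun s => Λ (translateBCF f s)) (cocompact ℝ) (𝓝 0) := by
  refine Metric.tendsto_nhds.2 fun ε hε => ?_
  simp only [dist_zero_right]
  by_contra h
  have hS : ¬ Bornology.IsBounded {s | ε ≤ ‖Λ (translateBCF f s)‖} := by
    rw [Bornology.isBounded_def, Metric.cobounded_eq_cocompact]
    exact fun hmem => h (by filter_upwards [hmem] with s hs using not_le.1 hs)
  obtain ⟨N, hN⟩ := exists_nat_gt (‖Λ‖ ^ 2 / ε ^ 2)
  obtain ⟨A, hcard, hAS, hsep⟩ := exists_separated_finset hS N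
  have h1 := sum_norm_sq_translateBCF_le hf horth Λ A hsep
  have h2 : N * ε ^ 2 ≤ ∑ s ∈ A, ‖Λ (translateBCF f s)‖ ^ 2 := by
    rw [← hcard, ← nsmul_eq_mul]
    exact Finset.card_nsmul_le_sum _ _ _ fun s hs => by
      have : ε ≤ ‖Λ (translateBCF f s)‖ := hAS hs
      gcongr
  rw [div_lt_iff₀ (by positivity)] at hN
  linarith

lemma tendsto_toWeakSpace_translateBCF {f : ℝ →ᵇ H} (hf : ‖f‖ ≤ 1)
    (horth : ∀ s t : ℝ, 1 < |s - t| → inner ℂ (f s) (f t) = 0) :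
    Tendsto (fun s => toWeakSpace ℂ (ℝ →ᵇ H) (translateBCF f s)) (cocompact ℝ) (𝓝 0) := by
  refine (WeakBilin.tendsto_iff_forall_eval_tendsto _ ?_).2 fun Λ => ?_
  · intro x y h
    by_contra hne
    obtain ⟨Λ, hΛ⟩ := SeparatingDual.exists_separating_of_ne (R := ℂ) hne
    exact hΛ (DFunLike.congr_fun h Λ)
  · have hlim := tendsto_apply_translateBCF hf horth Λ
    rw [← map_zero Λ] at hlim
    exact hlim

end Construction

lemma not_isCompact_closure_orbit {g : ℝ →ᵇ ℝ} (hpos : ∀ n : ℤ, 0 < n → g n = 1)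
    (hneg : ∀ n : ℤ, n ≤ 0 → g n = 0) :
    ¬ IsCompact (closure ((toWeakSpace ℝ (ℝ →ᵇ ℝ)) '' Set.range (translateBCF g))) := by
  intro hK
  let u : ℕ → WeakSpace ℝ (ℝ →ᵇ ℝ) := fun n => toWeakSpace ℝ (ℝ →ᵇ ℝ) (translateBCF g (-n))
  have hu : ∀ n, u n ∈ closure ((toWeakSpace ℝ (ℝ →ᵇ ℝ)) '' Set.range (translateBCF g)) :=
    fun n => subset_closure ⟨_, ⟨_, rfl⟩, rfl⟩
  obtain ⟨w, -, hw⟩ := hK.exists_mapClusterPt (f := atTop) (u := u) (tendsto_principal.2 (Eventually.of_forall hu))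
  obtain ⟨h, rfl⟩ := (toWeakSpace ℝ (ℝ →ᵇ ℝ)).surjective w
  have hzero : ∀ j : ℕ, h j = 0 := by
    intro j
    let ev : StrongDual ℝ (ℝ →ᵇ ℝ) := BoundedContinuousFunction.evalCLM ℝ (j : ℝ)
    have hev : Continuous fun v : WeakSpace ℝ (ℝ →ᵇ ℝ) =>
        ev ((toWeakSpace ℝ (ℝ →ᵇ ℝ)).symm v) := WeakBilin.eval_continuous _ ev
    have hmem := (isClosed_singleton (x := (0 : ℝ)).preimage hev).closure_subset
      (hw.clusterPt.mem_closure_of_mem _ (mem_map.2 ?_))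
    · exact hmem
    filter_upwards [eventually_ge_atTop j] with n hn
    have := hneg (-n + j) (by omega)
    push_cast at this
    exact this
  let C : Set (ℝ →ᵇ ℝ) := {k | ∀ᶠ j : ℕ in atTop, k j = 1}
  have hC : Convex ℝ C := by
    intro x hx y hy a b _ _ hab
    filter_upwards [hx, hy] with j hxj hyj
    simp [hxj, hyj, hab]
  have hmem : toWeakSpace ℝ (ℝ →ᵇ ℝ) h ∈ closure (toWeakSpace ℝ (ℝ →ᵇ ℝ) '' C) := by
    refine hw.clusterPt.mem_closure_of_mem _ ?_
    refine mem_map.2 (Eventually.of_forall fun n => ⟨_, ?_, rfl⟩)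
    filter_upwards [eventually_gt_atTop n] with j hj
    have := hpos (-n + j) (by omega)
    push_cast at this
    exact this
  rw [← hC.toWeakSpace_closure ℝ, (toWeakSpace ℝ (ℝ →ᵇ ℝ)).injective.mem_set_image] at hmem
  obtain ⟨k, hk, hhk⟩ := Metric.mem_closure_iff.1 hmem 1 one_pos
  obtain ⟨j, hj⟩ := hk.exists
  have := (BoundedContinuousFunction.dist_coe_le_dist (f := h) (g := k) (j : ℝ)).trans_lt hhk
  rw [hzero, hj] at this
  norm_num at this

lemma exists_orthonormal_nat {H : Type*} [NormedAddCommGroup H] [InnerProductSpace ℂ H]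
    [CompleteSpace H] (hH : ¬ FiniteDimensional ℂ H) : ∃ e : ℕ → H, Orthonormal ℂ e := by
  obtain ⟨w, b, -⟩ := exists_hilbertBasis ℂ H
  have : Infinite w := by
    by_contra hfin
    rw [not_infinite_iff_finite] at hfin
    refine hH (Module.finite_def.2 ?_)
    have := FiniteDimensional.span_of_finite ℂ (Set.finite_range b)
    rw [← b.dense_span, (Submodule.closed_of_finiteDimensional _).submodule_topologicalClosure_eq]
    exact Submodule.fg_span (Set.finite_range b)
  exact ⟨_, b.orthonormal.comp _ (Infinite.natEmbedding w).injective⟩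

/-- For every infinite-dimensional complex Hilbert space `H` there is an Eberlein almost
periodic `f : ℝ → H` (even `f ∈ EAP₀(ℝ,H)`) such that `t ↦ ‖f t‖` is not Eberlein almost
periodic: the orbit of `‖f(·)‖` is not relatively compact in the weak topology of
`C_b(ℝ,ℝ)`. -/
theorem exists_EAP0_norm_not_EAP
    (H : Type*) [NormedAddCommGroup H] [InnerProductSpace ℂ H] [CompleteSpace H]
    (hH : ¬ FiniteDimensional ℂ H) :
    ∃ f : ℝ →ᵇ H,
      IsCompact (closure ((toWeakSpace ℂ (ℝ →ᵇ H)) '' Set.range (translateBCF f))) ∧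
      (0 : WeakSpace ℂ (ℝ →ᵇ H)) ∈
        closure ((toWeakSpace ℂ (ℝ →ᵇ H)) '' Set.range (translateBCF f)) ∧
      ¬ IsCompact (closure ((toWeakSpace ℝ (ℝ →ᵇ ℝ)) ''
          Set.range (translateBCF f.normComp))) := by
  obtain ⟨e, he⟩ := exists_orthonormal_nat hH
  let F : ℤ → H := fun n => if 0 < n then e n.toNat else 0
  have hF : ∀ n, ‖F n‖ ≤ 1 := by
    intro n
    by_cases h : 0 < n <;> simp [F, h, he.1]
  have horth : Pairwise fun m n => inner ℂ (F m) (F n) = 0 := by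
    intro m n hmn
    by_cases hm : 0 < m <;> by_cases hn : 0 < n <;> simp only [F, hm, hn, if_true, if_false,
      inner_zero_left, inner_zero_right]
    exact he.2 (by omega)
  let f := bumpTrain F hF
  have hf : ‖f‖ ≤ 1 := BoundedContinuousFunction.norm_ofNormedAddCommGroup_le _ zero_le_one _
  have hlim := tendsto_toWeakSpace_translateBCF hf
    fun s t hst => inner_bumpTrain_eq_zero hF horth hst
  have hcont : Continuous fun s => toWeakSpace ℂ (ℝ →ᵇ H) (translateBCF f s) :=
    (toWeakSpaceCLM ℂ (ℝ →ᵇ H)).continuous.comp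
      (continuous_translateBCF (uniformContinuous_integerBump_smul hF))
  refine ⟨f, ?_, ?_, ?_⟩
  · rw [← Set.range_comp]
    exact (hlim.isCompact_insert_range_of_cocompact hcont).closure_of_subset
      (Set.subset_insert _ _)
  · rw [← Set.range_comp]
    exact mem_closure_of_tendsto hlim (Eventually.of_forall fun s => ⟨s, rfl⟩)
  · refine not_isCompact_closure_orbit (fun n hn => ?_) fun n hn => ?_
    · change ‖bumpTrain F hF n‖ = 1
      simp [norm_bumpTrain_intCast, F, hn, he.1]
    · change ‖bumpTrain F hF n‖ = 0
      simp [norm_bumpTrain_intCast, F, hn.not_gt]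
end
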